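/- For every integer m ≥ 1, Σ_{l=1}^{m} (−1)^{m−l} π^{2l−1}/(2l−1)! > 0. Equivalently, the partial sums of the Taylor series of sin evaluated at π, namely s_m = Σ_{l=1}^{m} (−1)^{l−1} π^{2l−1}/(2l−1)!, satisfy (−1)^{m−1} s_m > 0 for all m ≥ 1. -/

import Mathlib

open Real Finset

noncomputable def aux_f (i : ℕ) : ℝ := π ^ (2 * i + 3) / (Nat.factorial (2 * i + 3))

lemma aux_f_lt (i : ℕ) : aux_f (i + 1) < aux_f i := by
  unfold aux_f
  have h1 : (Nat.factorial (2 * (i + 1) + 3) : ℝ)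
      = (2 * i + 5) * (2 * i + 4) * (Nat.factorial (2 * i + 3)) := by
    rw [show 2 * (i + 1) + 3 = (2 * i + 3) + 1 + 1 by ring, Nat.factorial_succ, Nat.factorial_succ]
    push_cast
    ring
  have h2 : (0 : ℝ) < Nat.factorial (2 * i + 3) := by positivity
  have h3 : (0 : ℝ) < π ^ (2 * i + 3) := by positivity
  have h4 : π ^ 2 < (2 * i + 5) * (2 * i + 4) := by
    have : π ^ 2 < 16 := by nlinarith [Real.pi_lt_four, Real.pi_pos]
    have hi : (0 : ℝ) ≤ i := by positivity
    nlinarith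
  rw [h1, div_lt_div_iff₀ (by positivity) h2,
    show π ^ (2 * (i + 1) + 3) = π ^ (2 * i + 3) * π ^ 2 by ring]
  have := mul_lt_mul_of_pos_left h4 (mul_pos h3 h2)
  linarith

lemma aux_tendsto :
    Filter.Tendsto (fun n => ∑ i ∈ Finset.range n, (-1 : ℝ) ^ i * aux_f i) Filter.atTop (nhds π) := by
  have h := (Real.hasSum_sin π).tendsto_sum_nat
  rw [Real.sin_pi] at h
  have h2 := ((Filter.tendsto_add_atTop_iff_nat 1).2 h).const_sub π
  rw [sub_zero] at h2
  refine h2.congr fun n => ?_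
  rw [Finset.sum_range_succ', sub_eq_iff_eq_add, ← add_assoc, ← Finset.sum_add_distrib,
    Finset.sum_eq_zero]
  · simp
  · intro i _
    unfold aux_f
    rw [show 2 * (i + 1) + 1 = 2 * i + 3 by ring]
    ring

lemma aux_pos (n : ℕ) :
    0 < (-1 : ℝ) ^ n * (π - ∑ i ∈ Finset.range n, (-1 : ℝ) ^ i * aux_f i) := by
  have ha : Antitone aux_f := antitone_nat_of_succ_le fun i => (aux_f_lt i).le
  have hlt := aux_f_lt n
  obtain ⟨k, rfl | rfl⟩ := n.even_or_odd'
  · have h := ha.alternating_series_le_tendsto aux_tendsto (k + 1)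
    rw [show 2 * (k + 1) = 2 * k + 1 + 1 by ring, Finset.sum_range_succ, Finset.sum_range_succ] at h
    simp only [pow_succ, pow_mul] at h ⊢
    norm_num at h ⊢
    linarith
  · have h := ha.tendsto_le_alternating_series aux_tendsto (k + 1)
    rw [show 2 * (k + 1) + 1 = 2 * k + 1 + 1 + 1 by ring, Finset.sum_range_succ,
      Finset.sum_range_succ] at h
    simp only [pow_succ, pow_mul] at h ⊢
    norm_num at h ⊢
    linarith

lemma aux_sum (n : ℕ) :
    ∑ l ∈ Finset.Icc 1 (n + 1), (-1 : ℝ) ^ (l - 1) * π ^ (2 * l - 1) / (Nat.factorial (2 * l - 1))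
      = π - ∑ i ∈ Finset.range n, (-1 : ℝ) ^ i * aux_f i := by
  induction n with
  | zero => simp
  | succ n ih =>
    rw [Finset.sum_Icc_succ_top (by omega), ih, Finset.sum_range_succ]
    unfold aux_f
    rw [show 2 * (n + 1 + 1) - 1 = 2 * n + 3 by omega, show n + 1 + 1 - 1 = n + 1 by omega]
    ring

/-- Positivity of the alternating sums of the Taylor series of `sin` at `π`:
for every `m ≥ 1`, `∑_{l=1}^m (-1)^(m-l) π^(2l-1)/(2l-1)! > 0`; equivalently,
the partial sums `s_m = ∑_{l=1}^m (-1)^(l-1) π^(2l-1)/(2l-1)!` satisfy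
`(-1)^(m-1) s_m > 0`. -/
theorem stmt_8 :
    (∀ m : ℕ, 1 ≤ m →
      0 < ∑ l ∈ Finset.Icc 1 m,
            (-1 : ℝ) ^ (m - l) * π ^ (2 * l - 1) / (Nat.factorial (2 * l - 1))) ∧
    (∀ m : ℕ, 1 ≤ m →
      0 < (-1 : ℝ) ^ (m - 1) *
            ∑ l ∈ Finset.Icc 1 m,
              (-1 : ℝ) ^ (l - 1) * π ^ (2 * l - 1) / (Nat.factorial (2 * l - 1))) := by
  have key : ∀ m : ℕ, 1 ≤ m →
      0 < (-1 : ℝ) ^ (m - 1) *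
            ∑ l ∈ Finset.Icc 1 m,
              (-1 : ℝ) ^ (l - 1) * π ^ (2 * l - 1) / (Nat.factorial (2 * l - 1)) := by
    intro m hm
    obtain ⟨n, rfl⟩ : ∃ n, m = n + 1 := ⟨m - 1, by omega⟩
    rw [aux_sum]
    exact aux_pos n
  refine ⟨fun m hm => ?_, key⟩
  have h := key m hm
  rw [Finset.mul_sum] at h
  refine h.trans_eq (Finset.sum_congr rfl fun l hl => ?_)
  rw [Finset.mem_Icc] at hl
  have e : (-1 : ℝ) ^ (m - 1) * (-1 : ℝ) ^ (l - 1) = (-1 : ℝ) ^ (m - l) := by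
    rw [show m - 1 = (m - l) + (l - 1) by omega, pow_add, mul_assoc, ← mul_pow]
    simp
  rw [← e]
  ring
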